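/- Let A be a noetherian commutative ring and M a finitely generated meager A-module of infinite length whose set of associated primes is the singleton {P}. Then A/P has Krull dimension 1 (P has coheight 1), P annihilates M (so M is an A/P-module), and M is a torsion-free A/P-module of rank one; equivalently, M is isomorphic as an A/P-module to a nonzero A/P-submodule of Frac(A/P). -/

import Mathlib

/-- `X` is (isomorphic to) a subquotient of the `A`-module `M`. -/
def IsSubquotientOf (A : Type u) [CommRing A]
    (X : Type x) [AddCommGroup X] [Module A X]
    (M : Type v) [AddCommGroup M] [Module A M] : Prop :=
  ∃ (N : Submodule A M) (P : Submodule A (M ⧸ N)), Nonempty (X ≃ₗ[A] P)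

/-- An `A`-module `M` is meager if for every maximal ideal `𝔪` of `A`, `(A/𝔪)²` is not
isomorphic to a subquotient of `M`. -/
def IsMeagerModule (A : Type u) [CommRing A]
    (M : Type v) [AddCommGroup M] [Module A M] : Prop :=
  ∀ 𝔪 : Ideal A, 𝔪.IsMaximal → ¬ IsSubquotientOf A ((A ⧸ 𝔪) × (A ⧸ 𝔪)) M

theorem meager_aux_dep (A : Type*) [CommRing A] (M : Type*) [AddCommGroup M] [Module A M]
    (hmeager : IsMeagerModule A M) (𝔪 : Ideal A) (h𝔪 : 𝔪.IsMaximal) (x y : M) :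
    ∃ a b : A, (a ∉ 𝔪 ∨ b ∉ 𝔪) ∧ a • x = b • y := by
  by_contra hcon
  have key : ∀ a b : A, a • x = b • y → a ∈ 𝔪 ∧ b ∈ 𝔪 := by
    intro a b h
    by_contra h2
    exact hcon ⟨a, b, by tauto, h⟩
  let N : Submodule A M :=
    Submodule.map (LinearMap.toSpanSingleton A M x) 𝔪 ⊔ Submodule.map (LinearMap.toSpanSingleton A M y) 𝔪
  have memN : ∀ z, z ∈ N ↔ ∃ c ∈ 𝔪, ∃ d ∈ 𝔪, c • x + d • y = z := by
    intro z
    simp [N, Submodule.mem_sup]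
  let fx : (A ⧸ 𝔪) →ₗ[A] (M ⧸ N) := Submodule.liftQ 𝔪
    (N.mkQ ∘ₗ LinearMap.toSpanSingleton A M x) (by
      intro c hc
      simp only [LinearMap.mem_ker, LinearMap.comp_apply, LinearMap.toSpanSingleton_apply,
        Submodule.mkQ_apply, Submodule.Quotient.mk_eq_zero]
      exact (memN _).2 ⟨c, hc, 0, 𝔪.zero_mem, by simp⟩)
  let fy : (A ⧸ 𝔪) →ₗ[A] (M ⧸ N) := Submodule.liftQ 𝔪
    (N.mkQ ∘ₗ LinearMap.toSpanSingleton A M y) (by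
      intro c hc
      simp only [LinearMap.mem_ker, LinearMap.comp_apply, LinearMap.toSpanSingleton_apply,
        Submodule.mkQ_apply, Submodule.Quotient.mk_eq_zero]
      exact (memN _).2 ⟨0, 𝔪.zero_mem, c, hc, by simp⟩)
  let f : (A ⧸ 𝔪) × (A ⧸ 𝔪) →ₗ[A] (M ⧸ N) := fx.coprod fy
  have hf : Function.Injective f := by
    rw [injective_iff_map_eq_zero]
    rintro ⟨u, v⟩ h
    obtain ⟨a, rfl⟩ := Submodule.Quotient.mk_surjective _ u
    obtain ⟨b, rfl⟩ := Submodule.Quotient.mk_surjective _ v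
    have h1 : N.mkQ (a • x + b • y) = 0 := by
      rw [map_add]
      exact h
    rw [Submodule.mkQ_apply, Submodule.Quotient.mk_eq_zero, memN] at h1
    obtain ⟨c, hc, d, hd, h1⟩ := h1
    have h2 := key (a - c) (d - b) (by
      rw [sub_smul, sub_smul, sub_eq_sub_iff_add_eq_add, ← h1, add_comm])
    have ha : a ∈ 𝔪 := by simpa using 𝔪.add_mem h2.1 hc
    have hb : b ∈ 𝔪 := by simpa using 𝔪.sub_mem hd h2.2
    exact Prod.ext ((Submodule.Quotient.mk_eq_zero _).2 ha)
      ((Submodule.Quotient.mk_eq_zero _).2 hb)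
  exact hmeager 𝔪 h𝔪 ⟨N, LinearMap.range f, ⟨LinearEquiv.ofInjective f hf⟩⟩

/-- Saturation at `𝔪` of the cyclic submodule generated by `y`. -/
def meagerAuxSat {A : Type*} [CommRing A] {M : Type*} [AddCommGroup M] [Module A M]
    (𝔪 : Ideal A) (h𝔪 : 𝔪.IsPrime) (y : M) : Submodule A M where
  carrier := {n | ∃ e, e ∉ 𝔪 ∧ ∃ f : A, e • n = f • y}
  zero_mem' := ⟨1, fun h => h𝔪.ne_top ((Ideal.eq_top_iff_one _).2 h), 0, by simp⟩
  add_mem' := by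
    rintro n n' ⟨e, he, f, h⟩ ⟨e', he', f', h'⟩
    refine ⟨e * e', fun h => (h𝔪.mem_or_mem h).elim he he', e' * f + e * f', ?_⟩
    rw [smul_add, add_smul, mul_smul e' f, mul_smul e f', ← h, ← h', mul_smul, mul_smul,
      smul_comm e e' n]
  smul_mem' := by
    rintro c n ⟨e, he, f, h⟩
    exact ⟨e, he, c * f, by rw [mul_smul, ← h, smul_comm]⟩

theorem meager_aux_chain {A : Type*} [CommRing A] {M : Type*} [AddCommGroup M] [Module A M]
    [IsNoetherian A M] (𝔪 : Ideal A) (h𝔪 : 𝔪.IsPrime) (t : A) (ht : t ∈ 𝔪) (S : Set M)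
    (hne : S.Nonempty) (hann : ∀ y ∈ S, ∀ a : A, a • y = 0 → a ∈ 𝔪)
    (hS : ∀ y ∈ S, ∃ d, d ∉ 𝔪 ∧ ∃ y' ∈ S, d • y = t • y') : False := by
  obtain ⟨J, ⟨y, hy, rfl⟩, hmax⟩ := set_has_maximal_iff_noetherian.mpr ‹IsNoetherian A M›
    (Set.image (meagerAuxSat 𝔪 h𝔪) S) (hne.image _)
  obtain ⟨d, hd, y', hy', h⟩ := hS y hy
  have hle : meagerAuxSat 𝔪 h𝔪 y ≤ meagerAuxSat 𝔪 h𝔪 y' := by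
    rintro n ⟨e, he, f, h2⟩
    refine ⟨d * e, fun h => (h𝔪.mem_or_mem h).elim hd he, f * t, ?_⟩
    rw [mul_smul, h2, smul_comm, h, mul_smul]
  have heq : meagerAuxSat 𝔪 h𝔪 y' ≤ meagerAuxSat 𝔪 h𝔪 y := by
    by_contra hc
    exact hmax _ ⟨y', hy', rfl⟩ (lt_of_le_not_ge hle hc)
  have hmem : y' ∈ meagerAuxSat 𝔪 h𝔪 y' :=
    ⟨1, fun h => h𝔪.ne_top ((Ideal.eq_top_iff_one _).2 h), 1, rfl⟩
  obtain ⟨e, he, f, h3⟩ := heq hmem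
  have h4 : (e * d - t * f) • y = 0 := by
    rw [sub_smul, mul_smul, h, mul_smul, ← h3, smul_comm, sub_self]
  have h5 := hann y hy _ h4
  have h6 : e * d ∈ 𝔪 := by
    simpa using 𝔪.add_mem h5 (𝔪.mul_mem_right f ht)
  exact (h𝔪.mem_or_mem h6).elim he hd

theorem meager_aux_artinian (A : Type*) [CommRing A] [IsNoetherianRing A]
    (M : Type*) [AddCommGroup M] [Module A M] [hfin : Module.Finite A M]
    (h : ∀ Q : Ideal A, Q.IsPrime → Module.annihilator A M ≤ Q → Q.IsMaximal) :
    IsArtinian A M := by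
  induction hfin using IsNoetherianRing.induction_on_isQuotientEquivQuotientPrime A with
  | subsingleton N => infer_instance
  | quotient N p f =>
    have hm : p.1.IsMaximal := h p.1 p.2 (by
      rw [f.annihilator_eq, Ideal.annihilator_quotient])
    have : IsSimpleModule A (A ⧸ p.1) := by
      rw [isSimpleModule_iff_isCoatom]
      exact hm.out
    exact isArtinian_of_linearEquiv f.symm
  | exact N₁ N₂ N₃ f g hf hg hfg h₁ h₃ =>
    have := h₁ fun Q hQ hle => h Q hQ ((f.annihilator_le_of_injective hf).trans hle)
    have := h₃ fun Q hQ hle => h Q hQ ((g.annihilator_le_of_surjective hg).trans hle)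
    exact isArtinian_of_range_eq_ker f g hfg.linearMap_ker_eq.symm

/-- Let `A` be a noetherian commutative ring and `M` a finitely generated meager `A`-module
of infinite length with `Asso_A(M) = {P}`.  Then `A/P` has Krull dimension 1, `P`
annihilates `M`, and `M` is a torsion-free `A/P`-module of rank one (it is nonzero, scalars
outside `P` act injectively, and any two elements are `A/P`-linearly dependent). -/
theorem meager_fg_infinite_length_structure
    (A : Type u) [CommRing A] [IsNoetherianRing A]
    (M : Type v) [AddCommGroup M] [Module A M] [Module.Finite A M]
    (hmeager : IsMeagerModule A M) (hlen : ¬ IsFiniteLength A M)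
    (P : Ideal A) (hass : associatedPrimes A M = {P}) :
    ringKrullDim (A ⧸ P) = 1 ∧
      (∀ a ∈ P, ∀ m : M, a • m = 0) ∧
      Nontrivial M ∧
      (∀ a : A, a ∉ P → Function.Injective fun m : M => a • m) ∧
      (∀ x y : M, ∃ a b : A, (a ∉ P ∨ b ∉ P) ∧ a • x = b • y) := by
  have hPass : IsAssociatedPrime P M := by
    have : P ∈ associatedPrimes A M := by rw [hass]; rfl
    exact this
  have hP : P.IsPrime := hPass.isPrime
  have hnt : Nontrivial M := by
    by_contra hn
    rw [not_nontrivial_iff_subsingleton] at hn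
    exact not_isAssociatedPrime_of_subsingleton hPass
  -- zero divisors lie in `P`
  have hzd : ∀ (a : A) (m : M), m ≠ 0 → a • m = 0 → a ∈ P := by
    intro a m hm h
    have h1 : a ∈ ⋃ p ∈ associatedPrimes A M, (p : Set A) := by
      rw [biUnion_associatedPrimes_eq_zero_divisors]
      exact ⟨m, hm, h⟩
    rw [hass] at h1
    simpa using h1
  have hnoeth : IsNoetherian A M := inferInstance
  have hPmax : ¬ P.IsMaximal := by
    intro hmax
    apply hlen
    rw [isFiniteLength_iff_isNoetherian_isArtinian]
    refine ⟨hnoeth, meager_aux_artinian A M fun Q hQ hle => ?_⟩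
    obtain ⟨p, hp, hpQ⟩ := Ideal.exists_minimalPrimes_le hle
    have hpP := Module.associatedPrimes.minimalPrimes_annihilator_subset_associatedPrimes A M hp
    rw [hass, Set.mem_singleton_iff] at hpP
    subst hpP
    rwa [← hmax.eq_of_le hQ.ne_top hpQ]
  obtain ⟨𝔪, h𝔪, hP𝔪⟩ := P.exists_le_maximal hP.ne_top
  have hann : ∀ a ∈ P, ∀ m : M, a • m = 0 := by
    intro a ha m
    by_contra hne
    have hm : m ≠ 0 := by
      rintro rfl
      simp at hne
    obtain ⟨s, hs, hsP⟩ : ∃ s ∈ 𝔪, s ∉ P := by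
      by_contra! hc
      exact hPmax (le_antisymm hP𝔪 hc ▸ h𝔪)
    refine meager_aux_chain 𝔪 h𝔪.isPrime s hs {y : M | y ≠ 0 ∧ ∃ b ∈ P, b • m = y}
      ⟨a • m, hne, a, ha, rfl⟩ (fun y hy c hc => hP𝔪 (hzd c y hy.1 hc)) ?_
    rintro y ⟨hy, b, hb, rfl⟩
    obtain ⟨c, d, hcd, h⟩ := meager_aux_dep A M hmeager 𝔪 h𝔪 (s • m) (b • m)
    have h1 : (c * s - d * b) • m = 0 := by
      rw [sub_smul, mul_smul, mul_smul, h, sub_self]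
    have h2 : c * s ∈ P := by
      simpa using P.add_mem (hzd _ _ hm h1) (P.mul_mem_left d hb)
    have hc : c ∈ P := (hP.mem_or_mem h2).resolve_right hsP
    have hd : d ∉ 𝔪 := hcd.resolve_left (fun h => h (hP𝔪 hc))
    refine ⟨d, hd, c • m, ⟨fun h0 => ?_, c, hc, rfl⟩, ?_⟩
    · rw [smul_comm, h0, smul_zero] at h
      exact hd (hP𝔪 (hzd d _ hy h.symm))
    · rw [← h, smul_comm]
  refine ⟨?_, hann, hnt, ?_, ?_⟩
  · have hdom : IsDomain (A ⧸ P) := Ideal.Quotient.isDomain P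
    have hcomm : ∀ Q : Ideal A, Q.IsPrime → P ≤ Q → Q ≠ P → Q.IsMaximal := by
      intro Q hQ hPQ hne
      obtain ⟨𝔫, h𝔫, hQ𝔫⟩ := Q.exists_le_maximal hQ.ne_top
      obtain ⟨x, hx⟩ := exists_ne (0 : M)
      suffices 𝔫 ≤ Q from le_antisymm hQ𝔫 this ▸ h𝔫
      intro t ht
      by_contra htQ
      obtain ⟨s, hs, hsP⟩ : ∃ s ∈ Q, s ∉ P := by
        by_contra! hc
        exact hne (le_antisymm hc hPQ)
      refine meager_aux_chain 𝔫 h𝔫.isPrime t ht {y : M | y ≠ 0 ∧ ∃ b ∈ Q, b • x = y}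
        ⟨s • x, fun h => hsP (hzd s x hx h), s, hs, rfl⟩
        (fun y hy c hc => hQ𝔫 (hPQ (hzd c y hy.1 hc))) ?_
      rintro y ⟨hy, b, hb, rfl⟩
      obtain ⟨c, d, hcd, h⟩ := meager_aux_dep A M hmeager 𝔫 h𝔫 (b • x) (t • x)
      have h1 : (d * t - c * b) • x = 0 := by
        rw [sub_smul, mul_smul, mul_smul, h, sub_self]
      have h2 : d * t ∈ Q := by
        simpa using Q.add_mem (hPQ (hzd _ _ hx h1)) (Q.mul_mem_left c hb)
      have hd : d ∈ Q := (hQ.mem_or_mem h2).resolve_right htQ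
      have hc : c ∉ 𝔫 := hcd.resolve_right (fun h => h (hQ𝔫 hd))
      refine ⟨c, hc, d • x, ⟨fun h0 => ?_, d, hd, rfl⟩, ?_⟩
      · rw [smul_comm d, h0, smul_zero] at h
        exact hc (hQ𝔫 (hPQ (hzd c _ hy h)))
      · rw [h, smul_comm]
    apply eq_of_le_of_not_lt ?_ fun h' ↦ hPmax ?_
    · rw [← Nat.cast_one, ← Ring.krullDimLE_iff]
      refine Ring.KrullDimLE.mk₁' fun I hI hIp => ?_
      have hsurj : Function.Surjective (Ideal.Quotient.mk P) := Ideal.Quotient.mk_surjective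
      have hPle : P ≤ I.comap (Ideal.Quotient.mk P) := by
        intro a ha
        rw [Ideal.mem_comap, Ideal.Quotient.eq_zero_iff_mem.2 ha]
        exact I.zero_mem
      have hmax : (I.comap (Ideal.Quotient.mk P)).IsMaximal := by
        refine hcomm _ inferInstance hPle fun heq => hI ?_
        rw [← Ideal.map_comap_of_surjective _ hsurj I, heq, Ideal.map_quotient_self]
      rw [← Ideal.map_comap_of_surjective _ hsurj I]
      refine (Ideal.map_eq_top_or_isMaximal_of_surjective _ hsurj hmax).resolve_left ?_
      rw [Ideal.map_comap_of_surjective _ hsurj I]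
      exact hIp.ne_top
    · have h'' : ringKrullDim (A ⧸ P) ≤ 0 := Order.le_of_lt_succ h'
      rw [← Nat.cast_zero, ← Ring.krullDimLE_iff] at h''
      exact Ideal.Quotient.maximal_of_isField _ Ring.KrullDimLE.isField_of_isDomain
  · intro a ha m m' h
    by_contra hne
    refine ha (hzd a (m - m') (sub_ne_zero.2 hne) ?_)
    rw [smul_sub, sub_eq_zero]
    exact h
  · intro x y
    obtain ⟨a, b, hab, h⟩ := meager_aux_dep A M hmeager 𝔪 h𝔪 x y
    exact ⟨a, b, hab.imp (fun h h' => h (hP𝔪 h')) (fun h h' => h (hP𝔪 h')), h⟩
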